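/- arXiv:2503.17595 — 2 statements merged into one kernel-verified Lean document; each statement's English description precedes it below -/
import Mathlib

section
/- Let (ΛV,d) be a minimal Sullivan model and u a generator of odd degree with du ∈ ΛV, and let n ≥ 0, r ≥ 2 be integers. Then, inside the graded tensor power (ΛV ⊗ Λu)^{⊗r}, one has the inclusion of ideals (ker μ^r_{ΛV⊗Λu})^{n+r} ⊆ (ker μ^r_{ΛV})^{n+1} · (ΛV ⊗ Λu)^{⊗r}. -/
noncomputable section

namespace RHT

/-- A graded-commutative differential graded algebra over `ℚ`, graded by `ℕ`,
with a degree `+1` differential satisfying the graded Leibniz rule. -/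
class GCDGA (A : Type) extends Ring A, Algebra ℚ A where
  grading : ℕ → Submodule ℚ A
  gradedAlgebra : GradedAlgebra grading
  grading_comm : ∀ (i j : ℕ) (a b : A), a ∈ grading i → b ∈ grading j →
    a * b = ((-1 : ℚ) ^ (i * j)) • (b * a)
  d : A →ₗ[ℚ] A
  d_sq : ∀ a : A, d (d a) = 0
  d_grading : ∀ (i : ℕ) (a : A), a ∈ grading i → d a ∈ grading (i + 1)
  d_leibniz : ∀ (i : ℕ) (a b : A), a ∈ grading i →
    d (a * b) = d a * b + ((-1 : ℚ) ^ i) • (a * d b)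

/-- The grading of a gcdga, with the algebra explicit. -/
def Gr (A : Type) [GCDGA A] : ℕ → Submodule ℚ A := GCDGA.grading

/-- The differential of a gcdga, with the algebra explicit. -/
def Dd (A : Type) [GCDGA A] : A →ₗ[ℚ] A := GCDGA.d

/-- Morphisms of cdga's: `ℚ`-algebra morphisms preserving the grading and
commuting with the differentials. -/
def IsDGAHom {A B : Type} [GCDGA A] [GCDGA B] (f : A →ₐ[ℚ] B) : Prop :=
  (∀ a : A, f (Dd A a) = Dd B (f a)) ∧
    ∀ (i : ℕ) (a : A), a ∈ Gr A i → f a ∈ Gr B i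

theorem isDGAHom_id (A : Type) [GCDGA A] : IsDGAHom (AlgHom.id ℚ A) :=
  ⟨fun _ => rfl, fun _ _ h => h⟩

/-- A quasi-isomorphism: a morphism inducing an isomorphism in cohomology
(stated elementwise: surjectivity and injectivity on cohomology classes). -/
def QuasiIso {A B : Type} [GCDGA A] [GCDGA B] (f : A →ₐ[ℚ] B) : Prop :=
  (∀ b : B, Dd B b = 0 → ∃ a : A, Dd A a = 0 ∧ ∃ c : B, f a - b = Dd B c) ∧
    ∀ a : A, Dd A a = 0 → (∃ c : B, f a = Dd B c) → ∃ e : A, a = Dd A e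

/-- Injectivity in cohomology, stated elementwise. -/
def CohomologyInjective {A B : Type} [GCDGA A] [GCDGA B] (f : A →ₐ[ℚ] B) : Prop :=
  ∀ a : A, Dd A a = 0 → (∃ c : B, f a = Dd B c) → ∃ e : A, a = Dd A e

/-- A homotopy retraction for a morphism `ρ` of cdga's: a factorization of `ρ`
through a surjective quasi-isomorphism `q : C → Q` (playing the role of the
relative Sullivan model of `ρ`) together with a cdga retraction `τ`. -/
structure HtpyRetraction {T Q : Type} [GCDGA T] [GCDGA Q] (ρ : T →ₐ[ℚ] Q) where
  C : Type
  [instC : GCDGA C]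
  j : T →ₐ[ℚ] C
  q : C →ₐ[ℚ] Q
  τ : C →ₐ[ℚ] T
  j_dga : IsDGAHom j
  q_dga : IsDGAHom q
  τ_dga : IsDGAHom τ
  q_surj : Function.Surjective q
  q_quasi : QuasiIso q
  hqj : q.comp j = ρ
  hτj : τ.comp j = AlgHom.id ℚ T

attribute [instance] HtpyRetraction.instC

/-- A homotopy retraction of `T`-modules for a morphism `ρ : T → Q` of cdga's:
as above, but the retraction `τ` is only required to be a morphism of
differential `T`-modules. -/
structure ModHtpyRetraction {T Q : Type} [GCDGA T] [GCDGA Q] (ρ : T →ₐ[ℚ] Q) where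
  C : Type
  [instC : GCDGA C]
  j : T →ₐ[ℚ] C
  q : C →ₐ[ℚ] Q
  τ : C →ₗ[ℚ] T
  j_dga : IsDGAHom j
  q_dga : IsDGAHom q
  q_surj : Function.Surjective q
  q_quasi : QuasiIso q
  hqj : q.comp j = ρ
  τ_chain : ∀ c : C, τ (Dd C c) = Dd T (τ c)
  τ_mod : ∀ (t : T) (c : C), τ (j t * c) = t * τ c
  hτj : ∀ t : T, τ (j t) = t

attribute [instance] ModHtpyRetraction.instC

/-- `T`, together with the morphisms `ι j : A → T`, is the `r`-fold (graded)
tensor power of `A`, characterized as the `r`-fold coproduct of copies of `A`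
in the category of cdga's. -/
structure TensorPower (A : Type) [GCDGA A] (r : ℕ) (T : Type) [GCDGA T] where
  ι : Fin r → (A →ₐ[ℚ] T)
  ι_dga : ∀ j, IsDGAHom (ι j)
  coprod : ∀ (B : Type) [GCDGA B] (f : Fin r → (A →ₐ[ℚ] B)), (∀ j, IsDGAHom (f j)) →
    ∃! g : T →ₐ[ℚ] B, IsDGAHom g ∧ ∀ j, g.comp (ι j) = f j

/-- The `r`-fold multiplication morphism `μ : A^{⊗ r} → A`, i.e. the fold map
of the coproduct. -/
noncomputable def TensorPower.mu {A : Type} [GCDGA A] {r : ℕ} {T : Type} [GCDGA T]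
    (TP : TensorPower A r T) : T →ₐ[ℚ] A :=
  (TP.coprod A (fun _ => AlgHom.id ℚ A) (fun _ => isDGAHom_id A)).choose

/-- The kernel of the `r`-fold multiplication, as a `ℚ`-submodule (ideal). -/
noncomputable def TensorPower.kerMu {A : Type} [GCDGA A] {r : ℕ} {T : Type} [GCDGA T]
    (TP : TensorPower A r T) : Submodule ℚ T :=
  LinearMap.ker TP.mu.toLinearMap

/-- A witness that `TC_r(ΛV) ≤ n`: the projection
`ρ^r_n : (ΛV)^{⊗ r} → (ΛV)^{⊗ r}/(ker μ^r)^{n+1}` admits a homotopy retraction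
of cdga's.  The quotient is encoded as a surjective cdga morphism with kernel
`(ker μ^r)^{n+1}`. -/
structure TCWitness (A : Type) [GCDGA A] (r n : ℕ) where
  T : Type
  [instT : GCDGA T]
  TP : TensorPower A r T
  Q : Type
  [instQ : GCDGA Q]
  ρ : T →ₐ[ℚ] Q
  ρ_dga : IsDGAHom ρ
  ρ_surj : Function.Surjective ρ
  ρ_ker : LinearMap.ker ρ.toLinearMap = TP.kerMu ^ (n + 1)
  retr : Nonempty (HtpyRetraction ρ)

/-- The higher rational topological complexity `TC_r`. -/
noncomputable def TC (A : Type) [GCDGA A] (r : ℕ) : ℕ :=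
  sInf {n | Nonempty (TCWitness A r n)}

/-- A witness that `MTC_r(ΛV) ≤ n`: `ρ^r_n` admits a homotopy retraction of
`(ΛV)^{⊗ r}`-modules. -/
structure MTCWitness (A : Type) [GCDGA A] (r n : ℕ) where
  T : Type
  [instT : GCDGA T]
  TP : TensorPower A r T
  Q : Type
  [instQ : GCDGA Q]
  ρ : T →ₐ[ℚ] Q
  ρ_dga : IsDGAHom ρ
  ρ_surj : Function.Surjective ρ
  ρ_ker : LinearMap.ker ρ.toLinearMap = TP.kerMu ^ (n + 1)
  retr : Nonempty (ModHtpyRetraction ρ)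

/-- The higher module rational topological complexity `MTC_r`. -/
noncomputable def MTC (A : Type) [GCDGA A] (r : ℕ) : ℕ :=
  sInf {n | Nonempty (MTCWitness A r n)}

/-- A witness that `HTC_r(ΛV) ≤ n`: `ρ^r_n` is injective in cohomology. -/
structure HTCWitness (A : Type) [GCDGA A] (r n : ℕ) where
  T : Type
  [instT : GCDGA T]
  TP : TensorPower A r T
  Q : Type
  [instQ : GCDGA Q]
  ρ : T →ₐ[ℚ] Q
  ρ_dga : IsDGAHom ρ
  ρ_surj : Function.Surjective ρ
  ρ_ker : LinearMap.ker ρ.toLinearMap = TP.kerMu ^ (n + 1)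
  inj : CohomologyInjective ρ

/-- The invariant `HTC_r`. -/
noncomputable def HTC (A : Type) [GCDGA A] (r : ℕ) : ℕ :=
  sInf {n | Nonempty (HTCWitness A r n)}

/-- A minimal Sullivan model structure on a gcdga `A`: a simply-connected
graded space of generators `V` of finite type, the word-length grading `lam`
(`lam k` is `Λ^k V`), freeness of `A` over `V` as a graded-commutative
algebra (expressed by the universal property), and minimality `d V ⊆ Λ^{≥2}V`. -/
structure MinimalSullivan (A : Type) [GCDGA A] where
  V : ℕ → Submodule ℚ A
  lam : ℕ → Submodule ℚ A
  V_le : ∀ n, V n ≤ Gr A n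
  V0 : V 0 = ⊥
  V1 : V 1 = ⊥
  V_fin : ∀ n, FiniteDimensional ℚ (V n)
  lam_zero : lam 0 = 1
  lam_one : lam 1 = ⨆ n, V n
  lam_mul : ∀ p q, lam p * lam q ≤ lam (p + q)
  lam_internal : DirectSum.IsInternal lam
  minimal : ∀ (n : ℕ), ∀ v ∈ V n, Dd A v ∈ ⨆ k, ⨆ (_ : 2 ≤ k), lam k
  free : ∀ (B : Type) [GCDGA B] (f : ∀ n, V n →ₗ[ℚ] B),
    (∀ (n : ℕ) (v : V n), f n v ∈ Gr B n) →
    ∃! g : A →ₐ[ℚ] B, (∀ (i : ℕ) (a : A), a ∈ Gr A i → g a ∈ Gr B i) ∧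
      ∀ (n : ℕ) (v : V n), g (v : A) = f n v

namespace MinimalSullivan

variable {A : Type} [GCDGA A] (S : MinimalSullivan A)

/-- The even part of the space of generators. -/
def Veven : Submodule ℚ A := ⨆ n, S.V (2 * n)

/-- The odd part of the space of generators. -/
def Vodd : Submodule ℚ A := ⨆ n, S.V (2 * n + 1)

/-- The homotopy characteristic `χ_π = dim V^even - dim V^odd`. -/
noncomputable def chiPi : ℤ :=
  (Module.finrank ℚ S.Veven : ℤ) - (Module.finrank ℚ S.Vodd : ℤ)

/-- Purity: `d V^even = 0` and `d V^odd ⊆ Λ V^even`. -/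
def Pure : Prop :=
  (∀ a ∈ S.Veven, Dd A a = 0) ∧
    ∀ a ∈ S.Vodd, Dd A a ∈ Algebra.adjoin ℚ (S.Veven : Set A)

/-- Coformality: the differential is quadratic, `d V ⊆ Λ² V`. -/
def Coformal : Prop := ∀ (n : ℕ), ∀ v ∈ S.V n, Dd A v ∈ S.lam 2

/-- Constant length `l` of the differential: `d V ⊆ Λ^l V`. -/
def ConstantLength (l : ℕ) : Prop := ∀ (n : ℕ), ∀ v ∈ S.V n, Dd A v ∈ S.lam l

end MinimalSullivan

/-- The cohomology of a gcdga, as a `ℚ`-module. -/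
def CohClasses (A : Type) [GCDGA A] :=
  LinearMap.ker (Dd A) ⧸ ((LinearMap.range (Dd A)).comap (LinearMap.ker (Dd A)).subtype)

instance (A : Type) [GCDGA A] : AddCommGroup (CohClasses A) := by
  unfold CohClasses; infer_instance

instance (A : Type) [GCDGA A] : Module ℚ (CohClasses A) := by
  unfold CohClasses; infer_instance

/-- Ellipticity: both the generating space `V` and the cohomology are
finite-dimensional. -/
def Elliptic (A : Type) [GCDGA A] (S : MinimalSullivan A) : Prop :=
  FiniteDimensional ℚ (⨆ n, S.V n : Submodule ℚ A) ∧ FiniteDimensional ℚ (CohClasses A)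

/-- A witness of formality: a quasi-isomorphism to a gcdga with zero
differential. -/
structure FormalityWitness (A : Type) [GCDGA A] where
  B : Type
  [instB : GCDGA B]
  hd : Dd B = 0
  ψ : A →ₐ[ℚ] B
  ψ_dga : IsDGAHom ψ
  ψ_quasi : QuasiIso ψ

/-- Formality of a (Sullivan) cdga. -/
def Formal (A : Type) [GCDGA A] : Prop := Nonempty (FormalityWitness A)

/-- A witness that `cat(ΛV) ≤ n`: the projection `ΛV → ΛV/Λ^{>n}V` admits a
homotopy retraction.  The quotient is encoded as a surjective cdga morphism
whose kernel is `Λ^{>n}V`. -/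
structure CatWitness (A : Type) [GCDGA A] (S : MinimalSullivan A) (n : ℕ) where
  Q : Type
  [instQ : GCDGA Q]
  π : A →ₐ[ℚ] Q
  π_dga : IsDGAHom π
  π_surj : Function.Surjective π
  π_ker : LinearMap.ker π.toLinearMap = ⨆ k, ⨆ (_ : n < k), S.lam k
  retr : Nonempty (HtpyRetraction π)

/-- The rational LS-category. -/
noncomputable def cat (A : Type) [GCDGA A] (S : MinimalSullivan A) : ℕ :=
  sInf {n | Nonempty (CatWitness A S n)}

/-- A witness that `zcl_r(ΛV) ≥ p`: `p` cocycles in `(ΛV)^{⊗ r}` whose classes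
are zero-divisors (killed by `H(μ^r)`) and whose product is not exact. -/
structure ZclWitness (A : Type) [GCDGA A] (r p : ℕ) where
  T : Type
  [instT : GCDGA T]
  TP : TensorPower A r T
  a : Fin p → T
  closed : ∀ i, Dd T (a i) = 0
  zero_div : ∀ i, ∃ b : A, TP.mu (a i) = Dd A b
  prod_ne : ∀ b : T, (List.ofFn a).prod ≠ Dd T b

/-- The `r`-zero-divisor-cuplength `zcl_r`. -/
noncomputable def zcl (A : Type) [GCDGA A] (r : ℕ) : ℕ :=
  sSup {p | Nonempty (ZclWitness A r p)}

/-- A witness that `cl_ℚ(ΛV) ≥ p`: `p` cocycles of positive degree with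
non-exact product. -/
structure ClWitness (A : Type) [GCDGA A] (p : ℕ) where
  a : Fin p → A
  pos : ∀ i, a i ∈ ⨆ k, ⨆ (_ : 0 < k), Gr A k
  closed : ∀ i, Dd A (a i) = 0
  prod_ne : ∀ b : A, (List.ofFn a).prod ≠ Dd A b

/-- The rational cuplength `cl_ℚ`. -/
noncomputable def clQ (A : Type) [GCDGA A] : ℕ :=
  sSup {p | Nonempty (ClWitness A p)}


/-- A Sullivan extension `ΛV ⊗ Λu` of `ΛV` by one exterior generator `u` of odd
degree with `du ∈ ΛV`, characterized by its universal property. -/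
structure OddExtension (A : Type) [GCDGA A] (E : Type) [GCDGA E] where
  incl : A →ₐ[ℚ] E
  incl_dga : IsDGAHom incl
  u : E
  udeg : ℕ
  u_odd : Odd udeg
  u_mem : u ∈ Gr E udeg
  du : A
  hdu : incl du = Dd E u
  free : ∀ (B : Type) [GCDGA B] (f : A →ₐ[ℚ] B), IsDGAHom f →
    ∀ b : B, b ∈ Gr B udeg → Dd B b = f du →
    ∃! g : E →ₐ[ℚ] B, IsDGAHom g ∧ g.comp incl = f ∧ g u = b

section Homogeneous

variable {T : Type} [GCDGA T]

instance : GradedAlgebra (Gr T) := GCDGA.gradedAlgebra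

theorem mul_comm_of_mem {i j : ℕ} {a b : T} (ha : a ∈ Gr T i) (hb : b ∈ Gr T j) :
    a * b = ((-1 : ℚ) ^ (i * j)) • (b * a) :=
  GCDGA.grading_comm i j a b ha hb

theorem Dd_leibniz {i : ℕ} {a : T} (b : T) (ha : a ∈ Gr T i) :
    Dd T (a * b) = Dd T a * b + ((-1 : ℚ) ^ i) • (a * Dd T b) :=
  GCDGA.d_leibniz i a b ha

theorem Dd_mem {i : ℕ} {a : T} (ha : a ∈ Gr T i) : Dd T a ∈ Gr T (i + 1) :=
  GCDGA.d_grading i a ha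

theorem Dd_Dd (a : T) : Dd T (Dd T a) = 0 := GCDGA.d_sq a

theorem one_mem_Gr : (1 : T) ∈ Gr T 0 := SetLike.GradedOne.one_mem

theorem mul_mem_Gr {i j : ℕ} {a b : T} (ha : a ∈ Gr T i) (hb : b ∈ Gr T j) :
    a * b ∈ Gr T (i + j) := SetLike.GradedMul.mul_mem ha hb

theorem Dd_one : Dd T (1 : T) = 0 := by
  have h := Dd_leibniz (1 : T) one_mem_Gr
  simpa using h

theorem mul_self_eq_zero_of_odd {i : ℕ} (hi : Odd i) {a : T} (ha : a ∈ Gr T i) :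
    a * a = 0 := by
  have h := mul_comm_of_mem ha ha
  rw [(hi.mul hi).neg_one_pow, neg_smul, one_smul] at h
  have h2 : (2 : ℚ) • (a * a) = 0 := by
    rw [two_smul]; nth_rewrite 1 [h]; exact neg_add_cancel _
  exact (smul_eq_zero.mp h2).resolve_left two_ne_zero

theorem iSup_Gr : ⨆ k, Gr T k = ⊤ :=
  (DirectSum.Decomposition.isInternal (Gr T)).submodule_iSup_eq_top

theorem induction_Gr {P : T → Prop} (h : ∀ i, ∀ a ∈ Gr T i, P a)
    (hadd : ∀ a b, P a → P b → P (a + b)) (a : T) : P a := by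
  have ha : a ∈ ⨆ k, Gr T k := by rw [iSup_Gr]; trivial
  exact Submodule.iSup_induction (Gr T) (motive := P) ha h (h 0 0 (zero_mem _)) hadd

/-- A subspace spanned by homogeneous elements. -/
def IsHomogeneousSubmodule (P : Submodule ℚ T) : Prop := P ≤ ⨆ k, P ⊓ Gr T k

theorem IsHomogeneousSubmodule.top : IsHomogeneousSubmodule (⊤ : Submodule ℚ T) := by
  simp [IsHomogeneousSubmodule, iSup_Gr]

theorem IsHomogeneousSubmodule.mul_le {P Q : Submodule ℚ T} (hP : IsHomogeneousSubmodule P)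
    (hQ : IsHomogeneousSubmodule Q) : P * Q ≤ Q * P := by
  refine (mul_le_mul' hP hQ).trans ?_
  rw [Submodule.iSup_mul]
  refine iSup_le fun i => ?_
  rw [Submodule.mul_iSup]
  refine iSup_le fun j => Submodule.mul_le.2 ?_
  rintro a ⟨haP, ha⟩ b ⟨hbQ, hb⟩
  rw [mul_comm_of_mem ha hb]
  exact Submodule.smul_mem _ _ (Submodule.mul_mem_mul hbQ haP)

theorem IsHomogeneousSubmodule.commute {P Q : Submodule ℚ T} (hP : IsHomogeneousSubmodule P)
    (hQ : IsHomogeneousSubmodule Q) : Commute P Q :=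
  le_antisymm (hP.mul_le hQ) (hQ.mul_le hP)

theorem isHomogeneousSubmodule_span {s : Set T} (hs : ∀ x ∈ s, ∃ i, x ∈ Gr T i) :
    IsHomogeneousSubmodule (Submodule.span ℚ s) := by
  refine Submodule.span_le.2 fun x hx => ?_
  obtain ⟨i, hi⟩ := hs x hx
  exact Submodule.mem_iSup_of_mem i ⟨Submodule.subset_span hx, hi⟩

theorem IsHomogeneousSubmodule.map {B : Type} [GCDGA B] {f : T →ₐ[ℚ] B} (hf : IsDGAHom f)
    {P : Submodule ℚ T} (hP : IsHomogeneousSubmodule P) :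
    IsHomogeneousSubmodule (P.map f.toLinearMap) := by
  refine (Submodule.map_mono hP).trans ?_
  rw [Submodule.map_iSup]
  refine iSup_mono fun k => ?_
  rintro _ ⟨x, ⟨hx, hk⟩, rfl⟩
  exact ⟨⟨x, hx, rfl⟩, hf.2 k x hk⟩

theorem IsDGAHom.map_proj {B : Type} [GCDGA B] {f : T →ₐ[ℚ] B} (hf : IsDGAHom f) (k : ℕ)
    (x : T) : f (GradedAlgebra.proj (Gr T) k x) = GradedAlgebra.proj (Gr B) k (f x) := by
  refine induction_Gr (P := fun x => f (GradedAlgebra.proj (Gr T) k x) =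
    GradedAlgebra.proj (Gr B) k (f x)) (fun i a ha => ?_) (fun a b ha hb => ?_) x
  · rw [GradedAlgebra.proj_apply, GradedAlgebra.proj_apply]
    by_cases h : i = k
    · subst h
      rw [DirectSum.decompose_of_mem_same _ ha, DirectSum.decompose_of_mem_same _ (hf.2 i a ha)]
    · rw [DirectSum.decompose_of_mem_ne _ ha h,
        DirectSum.decompose_of_mem_ne _ (hf.2 i a ha) h, map_zero]
  · simp only [map_add, ha, hb]

theorem IsDGAHom.isHomogeneousSubmodule_ker {B : Type} [GCDGA B] {f : T →ₐ[ℚ] B}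
    (hf : IsDGAHom f) : IsHomogeneousSubmodule (LinearMap.ker f.toLinearMap) := by
  classical
  intro x hx
  rw [← DirectSum.sum_support_decompose (Gr T) x]
  refine sum_mem fun k _ => Submodule.mem_iSup_of_mem k ⟨?_, SetLike.coe_mem _⟩
  have h := hf.map_proj k x
  rw [show f x = 0 from hx, map_zero, GradedAlgebra.proj_apply] at h
  exact h

end Homogeneous

/-- A grading by subspaces which are multiplicative, independent and span. -/
@[reducible] def gradedAlgebraOfIndep {A : Type} [Ring A] [Algebra ℚ A] (𝒢 : ℕ → Submodule ℚ A)
    (one : (1 : A) ∈ 𝒢 0) (mul : ∀ {i j a b}, a ∈ 𝒢 i → b ∈ 𝒢 j → a * b ∈ 𝒢 (i + j))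
    (indep : iSupIndep 𝒢) (top : ⨆ k, 𝒢 k = ⊤) : GradedAlgebra 𝒢 :=
  letI : DirectSum.Decomposition 𝒢 := DirectSum.IsInternal.chooseDecomposition 𝒢
    ((DirectSum.isInternal_submodule_iff_iSupIndep_and_iSup_eq_top 𝒢).2 ⟨indep, top⟩)
  { one_mem := one
    mul_mem := by
      intro i j a b ha hb
      exact mul ha hb }

theorem iSupIndep_of_projections {M N : Type} [AddCommGroup M] [Module ℚ M]
    [AddCommGroup N] [Module ℚ N] (𝒢 : ℕ → Submodule ℚ M) (q : ℕ → M →ₗ[ℚ] N)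
    (hq : ∀ k, ∀ x ∈ 𝒢 k, q k x = 0 → x = 0) (hq0 : ∀ k l, l ≠ k → ∀ x ∈ 𝒢 l, q k x = 0) :
    iSupIndep 𝒢 := by
  intro k
  rw [Submodule.disjoint_def]
  intro x hx hx'
  refine hq k x hx ?_
  have h : ⨆ j, ⨆ (_ : j ≠ k), 𝒢 j ≤ LinearMap.ker (q k) :=
    iSup₂_le fun l hl y hy => hq0 k l hl y hy
  exact h hx'

section Generation

variable {T : Type} [GCDGA T]

/-- A homogeneous subalgebra stable under the differential is a gcdga. -/
@[reducible] def subGCDGA (S : Subalgebra ℚ T)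
    (hS : IsHomogeneousSubmodule (Subalgebra.toSubmodule S))
    (hd : ∀ x ∈ S, Dd T x ∈ S) : GCDGA S :=
  { (inferInstance : Ring S), (inferInstance : Algebra ℚ S) with
    grading := fun k => (Gr T k).comap S.val.toLinearMap
    gradedAlgebra := by
      refine gradedAlgebraOfIndep _ one_mem_Gr (fun ha hb => mul_mem_Gr ha hb) ?_ ?_
      · refine iSupIndep_of_projections _
          (fun k => (GradedAlgebra.proj (Gr T) k).comp S.val.toLinearMap) ?_ ?_
        · intro k x hx h
          have h' : ((DirectSum.decompose (Gr T) (x : T) k : Gr T k) : T) = 0 := h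
          have hx' : (x : T) ∈ Gr T k := hx
          rw [DirectSum.decompose_of_mem_same _ hx'] at h'
          exact Subtype.ext h'
        · intro k l hl x hx
          have hx' : (x : T) ∈ Gr T l := hx
          exact DirectSum.decompose_of_mem_ne (Gr T) hx' hl
      · rw [eq_top_iff]
        have hinj : Function.Injective (S.val.toLinearMap) := Subtype.val_injective
        rw [← Submodule.map_le_map_iff_of_injective hinj, Submodule.map_iSup]
        rintro _ ⟨x, -, rfl⟩
        have hle : ⨆ k, Subalgebra.toSubmodule S ⊓ Gr T k ≤
            ⨆ k, ((Gr T k).comap S.val.toLinearMap).map S.val.toLinearMap :=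
          iSup_mono fun k y hy => ⟨⟨y, hy.1⟩, hy.2, rfl⟩
        exact hle (hS x.2)
    grading_comm := fun i j a b ha hb => Subtype.ext (mul_comm_of_mem ha hb)
    d := (Dd T).restrict (p := Subalgebra.toSubmodule S) (q := Subalgebra.toSubmodule S) hd
    d_sq := fun a => Subtype.ext (Dd_Dd _)
    d_grading := fun i a ha => Dd_mem ha
    d_leibniz := fun i a b ha => Subtype.ext (Dd_leibniz _ ha) }

theorem mem_closure_homogeneous {s : Set T} (hs : ∀ x ∈ s, ∃ i, x ∈ Gr T i)
    (hd : ∀ x ∈ s, Dd T x ∈ Algebra.adjoin ℚ s) {x : T} (hx : x ∈ Submonoid.closure s) :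
    (∃ i, x ∈ Gr T i) ∧ Dd T x ∈ Algebra.adjoin ℚ s := by
  have hsub : ∀ y ∈ Submonoid.closure s, y ∈ Algebra.adjoin ℚ s := fun y hy => by
    rw [← Subalgebra.mem_toSubmodule, Algebra.adjoin_eq_span]
    exact Submodule.subset_span hy
  induction hx using Submonoid.closure_induction with
  | mem x hx => exact ⟨hs x hx, hd x hx⟩
  | one => exact ⟨⟨0, one_mem_Gr⟩, by rw [Dd_one]; exact zero_mem _⟩
  | mul x y hx hy ihx ihy =>
    obtain ⟨⟨i, hi⟩, hdx⟩ := ihx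
    obtain ⟨⟨j, hj⟩, hdy⟩ := ihy
    refine ⟨⟨i + j, mul_mem_Gr hi hj⟩, ?_⟩
    rw [Dd_leibniz _ hi]
    exact add_mem (mul_mem hdx (hsub y hy)) (Subalgebra.smul_mem _ (mul_mem (hsub x hx) hdy) _)

theorem isHomogeneousSubmodule_adjoin {s : Set T} (hs : ∀ x ∈ s, ∃ i, x ∈ Gr T i)
    (hd : ∀ x ∈ s, Dd T x ∈ Algebra.adjoin ℚ s) :
    IsHomogeneousSubmodule (Subalgebra.toSubmodule (Algebra.adjoin ℚ s)) := by
  rw [Algebra.adjoin_eq_span]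
  exact isHomogeneousSubmodule_span fun x hx => (mem_closure_homogeneous hs hd hx).1

theorem Dd_mem_adjoin {s : Set T} (hs : ∀ x ∈ s, ∃ i, x ∈ Gr T i)
    (hd : ∀ x ∈ s, Dd T x ∈ Algebra.adjoin ℚ s) (x : T) (hx : x ∈ Algebra.adjoin ℚ s) :
    Dd T x ∈ Algebra.adjoin ℚ s := by
  have h : Submodule.span ℚ (Submonoid.closure s : Set T) ≤
      (Subalgebra.toSubmodule (Algebra.adjoin ℚ s)).comap (Dd T) :=
    Submodule.span_le.2 fun y hy => (mem_closure_homogeneous hs hd hy).2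
  rw [← Subalgebra.mem_toSubmodule, Algebra.adjoin_eq_span] at hx
  exact h hx

/-- Corestriction of a morphism of cdga's to a sub-cdga is a morphism of cdga's. -/
theorem isDGAHom_codRestrict {B : Type} [GCDGA B] {f : B →ₐ[ℚ] T} (hf : IsDGAHom f)
    (S : Subalgebra ℚ T) (hS : IsHomogeneousSubmodule (Subalgebra.toSubmodule S))
    (hd : ∀ x ∈ S, Dd T x ∈ S) (h : ∀ x, f x ∈ S) :
    letI := subGCDGA S hS hd
    IsDGAHom (f.codRestrict S h) :=
  ⟨fun a => Subtype.ext (hf.1 a), fun i a ha => hf.2 i a ha⟩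

theorem isDGAHom_val (S : Subalgebra ℚ T)
    (hS : IsHomogeneousSubmodule (Subalgebra.toSubmodule S)) (hd : ∀ x ∈ S, Dd T x ∈ S) :
    letI := subGCDGA S hS hd
    IsDGAHom S.val :=
  ⟨fun _ => rfl, fun _ _ ha => ha⟩

theorem IsDGAHom.comp {A B C : Type} [GCDGA A] [GCDGA B] [GCDGA C] {g : B →ₐ[ℚ] C}
    {f : A →ₐ[ℚ] B} (hg : IsDGAHom g) (hf : IsDGAHom f) : IsDGAHom (g.comp f) :=
  ⟨fun a => by simp [hf.1, hg.1], fun i a ha => hg.2 i _ (hf.2 i a ha)⟩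

theorem map_mem_of_homogeneous {B : Type} [GCDGA B] {f : B →ₐ[ℚ] T} {S : Subalgebra ℚ T}
    (h : ∀ i, ∀ a ∈ Gr B i, f a ∈ S) (a : B) : f a ∈ S :=
  induction_Gr (P := fun a => f a ∈ S) h
    (fun a b ha hb => by rw [map_add]; exact add_mem ha hb) a

/-- A tensor power is generated by the images of the factors. -/
theorem TensorPower.eq_top_of_range_le {A : Type} [GCDGA A] {r : ℕ} (P : TensorPower A r T)
    (S : Subalgebra ℚ T) (hS : ∀ k a, P.ι k a ∈ S) : S = ⊤ := by
  set s : Set T := {x | ∃ k i, ∃ a ∈ Gr A i, P.ι k a = x}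
  have hs : ∀ x ∈ s, ∃ i, x ∈ Gr T i := by
    rintro _ ⟨k, i, a, ha, rfl⟩
    exact ⟨i, (P.ι_dga k).2 i a ha⟩
  have hd : ∀ x ∈ s, Dd T x ∈ Algebra.adjoin ℚ s := by
    rintro _ ⟨k, i, a, ha, rfl⟩
    rw [← (P.ι_dga k).1]
    exact Algebra.subset_adjoin ⟨k, i + 1, _, Dd_mem ha, rfl⟩
  have hι : ∀ k a, P.ι k a ∈ Algebra.adjoin ℚ s := fun k =>
    map_mem_of_homogeneous fun i a ha => Algebra.subset_adjoin ⟨k, i, a, ha, rfl⟩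
  have hH := isHomogeneousSubmodule_adjoin hs hd
  have hD := Dd_mem_adjoin hs hd
  let _ := subGCDGA _ hH hD
  obtain ⟨g, ⟨hg, hgι⟩, -⟩ := P.coprod (Algebra.adjoin ℚ s)
    (fun k => (P.ι k).codRestrict _ (hι k))
    (fun k => isDGAHom_codRestrict (P.ι_dga k) _ hH hD (hι k))
  have huniq := (P.coprod T P.ι P.ι_dga).unique
    (y₁ := (Algebra.adjoin ℚ s).val.comp g) (y₂ := AlgHom.id ℚ T)
    ⟨(isDGAHom_val _ hH hD).comp hg, fun k => by
      rw [AlgHom.comp_assoc, hgι]; rfl⟩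
    ⟨isDGAHom_id T, fun k => AlgHom.id_comp _⟩
  rw [eq_top_iff]
  intro x _
  have hx : ((g x : Algebra.adjoin ℚ s) : T) = x := DFunLike.congr_fun huniq x
  have hle : Algebra.adjoin ℚ s ≤ S := Algebra.adjoin_le (by
    rintro _ ⟨k, i, a, ha, rfl⟩
    exact hS k a)
  rw [← hx]
  exact hle (g x).2

/-- `ΛV ⊗ Λu` is generated by `ΛV` and `u`. -/
theorem OddExtension.eq_top_of_mem {A : Type} [GCDGA A] (ext : OddExtension A T)
    (S : Subalgebra ℚ T) (hS : ∀ a, ext.incl a ∈ S) (hu : ext.u ∈ S) : S = ⊤ := by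
  set s : Set T := insert ext.u {x | ∃ i, ∃ a ∈ Gr A i, ext.incl a = x}
  have hι : ∀ a, ext.incl a ∈ Algebra.adjoin ℚ s :=
    map_mem_of_homogeneous fun i a ha => Algebra.subset_adjoin (Or.inr ⟨i, a, ha, rfl⟩)
  have hus : ext.u ∈ Algebra.adjoin ℚ s := Algebra.subset_adjoin (Or.inl rfl)
  have hs : ∀ x ∈ s, ∃ i, x ∈ Gr T i := by
    rintro _ (rfl | ⟨i, a, ha, rfl⟩)
    · exact ⟨_, ext.u_mem⟩
    · exact ⟨i, ext.incl_dga.2 i a ha⟩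
  have hd : ∀ x ∈ s, Dd T x ∈ Algebra.adjoin ℚ s := by
    rintro _ (rfl | ⟨i, a, ha, rfl⟩)
    · rw [← ext.hdu]
      exact hι _
    · rw [← ext.incl_dga.1]
      exact hι _
  have hH := isHomogeneousSubmodule_adjoin hs hd
  have hD := Dd_mem_adjoin hs hd
  let _ := subGCDGA _ hH hD
  obtain ⟨g, ⟨hg, hgι, hgu⟩, -⟩ := ext.free (Algebra.adjoin ℚ s)
    (ext.incl.codRestrict _ hι) (isDGAHom_codRestrict ext.incl_dga _ hH hD hι)
    ⟨ext.u, hus⟩ ext.u_mem (Subtype.ext ext.hdu.symm)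
  have huniq := (ext.free T ext.incl ext.incl_dga ext.u ext.u_mem ext.hdu.symm).unique
    (y₁ := (Algebra.adjoin ℚ s).val.comp g) (y₂ := AlgHom.id ℚ T)
    ⟨(isDGAHom_val _ hH hD).comp hg, by rw [AlgHom.comp_assoc, hgι]; rfl, by
      rw [AlgHom.comp_apply, hgu]; rfl⟩
    ⟨isDGAHom_id T, AlgHom.id_comp _, rfl⟩
  rw [eq_top_iff]
  intro x _
  have hx : ((g x : Algebra.adjoin ℚ s) : T) = x := DFunLike.congr_fun huniq x
  have hle : Algebra.adjoin ℚ s ≤ S := Algebra.adjoin_le (by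
    rintro _ (rfl | ⟨i, a, ha, rfl⟩)
    · exact hu
    · exact hS a)
  rw [← hx]
  exact hle (g x).2

end Generation

section ExteriorAdjunction

variable {C : Type} [GCDGA C]

/-- The degree involution `a ↦ (-1)^|a| a`, as a linear map. -/
def degreeInvolution (C : Type) [GCDGA C] : C →ₗ[ℚ] C :=
  (DirectSum.toModule ℚ ℕ C fun i => ((-1 : ℚ) ^ i) • (Gr C i).subtype).comp
    (DirectSum.decomposeLinearEquiv (Gr C)).toLinearMap

theorem degreeInvolution_of_mem {i : ℕ} {a : C} (ha : a ∈ Gr C i) :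
    degreeInvolution C a = ((-1 : ℚ) ^ i) • a := by
  simp only [degreeInvolution, LinearMap.comp_apply, LinearEquiv.coe_coe,
    DirectSum.decomposeLinearEquiv_apply]
  rw [DirectSum.decompose_of_mem _ ha]
  erw [DirectSum.toModule_lof]
  rfl

theorem degreeInvolution_one : degreeInvolution C 1 = 1 := by
  simpa using degreeInvolution_of_mem (C := C) one_mem_Gr

theorem degreeInvolution_mul (a b : C) :
    degreeInvolution C (a * b) = degreeInvolution C a * degreeInvolution C b := by
  refine induction_Gr (P := fun a => degreeInvolution C (a * b) =
    degreeInvolution C a * degreeInvolution C b) (fun i a ha => ?_) (fun x y hx hy => ?_) a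
  · refine induction_Gr (P := fun b => degreeInvolution C (a * b) =
      degreeInvolution C a * degreeInvolution C b) (fun j b hb => ?_) (fun x y hx hy => ?_) b
    · rw [degreeInvolution_of_mem (mul_mem_Gr ha hb), degreeInvolution_of_mem ha,
        degreeInvolution_of_mem hb, smul_mul_smul_comm, pow_add]
    · simp only [mul_add, map_add, hx, hy]
  · simp only [add_mul, map_add, hx, hy]

theorem degreeInvolution_degreeInvolution (a : C) :
    degreeInvolution C (degreeInvolution C a) = a := by
  refine induction_Gr (P := fun a => degreeInvolution C (degreeInvolution C a) = a)
    (fun i a ha => ?_) (fun x y hx hy => ?_) a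
  · rw [degreeInvolution_of_mem ha, map_smul, degreeInvolution_of_mem ha, smul_smul,
      ← mul_pow]
    simp
  · simp only [map_add, hx, hy]

theorem Dd_degreeInvolution (a : C) :
    Dd C (degreeInvolution C a) = -degreeInvolution C (Dd C a) := by
  refine induction_Gr (P := fun a => Dd C (degreeInvolution C a) = -degreeInvolution C (Dd C a))
    (fun i a ha => ?_) (fun x y hx hy => ?_) a
  · rw [degreeInvolution_of_mem ha, map_smul, degreeInvolution_of_mem (Dd_mem ha), pow_succ]
    simp
  · simp only [map_add, hx, hy, neg_add]

/-- The underlying space of `C ⊗ Λu`; the pair `(a, b)` stands for `a + b u`. -/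
@[ext] structure AdjoinOdd (C : Type) where
  fst : C
  snd : C

namespace AdjoinOdd

instance : Zero (AdjoinOdd C) := ⟨⟨0, 0⟩⟩

instance : One (AdjoinOdd C) := ⟨⟨1, 0⟩⟩

instance : Add (AdjoinOdd C) := ⟨fun x y => ⟨x.fst + y.fst, x.snd + y.snd⟩⟩

instance : Neg (AdjoinOdd C) := ⟨fun x => ⟨-x.fst, -x.snd⟩⟩

instance : SMul ℚ (AdjoinOdd C) := ⟨fun c x => ⟨c • x.fst, c • x.snd⟩⟩

instance : Mul (AdjoinOdd C) :=
  ⟨fun x y => ⟨x.fst * y.fst, x.fst * y.snd + x.snd * degreeInvolution C y.fst⟩⟩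

@[simp] theorem zero_fst : (0 : AdjoinOdd C).fst = 0 := rfl
@[simp] theorem zero_snd : (0 : AdjoinOdd C).snd = 0 := rfl
@[simp] theorem one_fst : (1 : AdjoinOdd C).fst = 1 := rfl
@[simp] theorem one_snd : (1 : AdjoinOdd C).snd = 0 := rfl
@[simp] theorem add_fst (x y : AdjoinOdd C) : (x + y).fst = x.fst + y.fst := rfl
@[simp] theorem add_snd (x y : AdjoinOdd C) : (x + y).snd = x.snd + y.snd := rfl
@[simp] theorem neg_fst (x : AdjoinOdd C) : (-x).fst = -x.fst := rfl
@[simp] theorem neg_snd (x : AdjoinOdd C) : (-x).snd = -x.snd := rfl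
@[simp] theorem smul_fst (c : ℚ) (x : AdjoinOdd C) : (c • x).fst = c • x.fst := rfl
@[simp] theorem smul_snd (c : ℚ) (x : AdjoinOdd C) : (c • x).snd = c • x.snd := rfl
@[simp] theorem mul_fst (x y : AdjoinOdd C) : (x * y).fst = x.fst * y.fst := rfl
@[simp] theorem mul_snd (x y : AdjoinOdd C) :
    (x * y).snd = x.fst * y.snd + x.snd * degreeInvolution C y.fst := rfl

instance : Ring (AdjoinOdd C) :=
  Ring.ofMinimalAxioms
    (fun x y z => by ext <;> simp [add_assoc])
    (fun x => by ext <;> simp)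
    (fun x => by ext <;> simp)
    (fun x y z => by
      ext
      · simp [mul_assoc]
      · simp [mul_assoc, degreeInvolution_mul, mul_add, add_mul, add_assoc])
    (fun x => by ext <;> simp)
    (fun x => by ext <;> simp [degreeInvolution_one])
    (fun x y z => by
      ext
      · simp [mul_add]
      · simp only [mul_snd, add_snd, add_fst, map_add, mul_add]
        abel)
    (fun x y z => by
      ext
      · simp [add_mul]
      · simp only [mul_snd, add_snd, add_fst, add_mul]
        abel)

instance : Module ℚ (AdjoinOdd C) where
  one_smul x := by ext <;> simp
  mul_smul c e x := by ext <;> simp [mul_smul]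
  smul_zero c := by ext <;> simp
  smul_add c x y := by ext <;> simp
  add_smul c e x := by ext <;> simp [add_smul]
  zero_smul x := by ext <;> simp

instance : Algebra ℚ (AdjoinOdd C) :=
  Algebra.ofModule (fun c x y => by ext <;> simp [smul_add])
    (fun c x y => by ext <;> simp [smul_add])

/-- The coefficients of an element of `C ⊗ Λu`. -/
def toProd (C : Type) [GCDGA C] : AdjoinOdd C →ₗ[ℚ] C × C where
  toFun x := (x.fst, x.snd)
  map_add' _ _ := rfl
  map_smul' _ _ := rfl

/-- The `k`-th graded piece of the summand `C u`, where `u` has degree `m`. -/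
def shiftGr (C : Type) [GCDGA C] (m k : ℕ) : Submodule ℚ C :=
  if m ≤ k then Gr C (k - m) else ⊥

theorem mem_shiftGr_add {m j : ℕ} {b : C} (hb : b ∈ Gr C j) : b ∈ shiftGr C m (j + m) := by
  simpa [shiftGr] using hb

theorem eq_zero_or_of_mem_shiftGr {m k : ℕ} {b : C} (hb : b ∈ shiftGr C m k) :
    b = 0 ∨ ∃ j, j + m = k ∧ b ∈ Gr C j := by
  unfold shiftGr at hb
  split_ifs at hb with h
  · exact Or.inr ⟨k - m, Nat.sub_add_cancel h, hb⟩
  · exact Or.inl hb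

theorem degreeInvolution_of_mem_shiftGr {m k : ℕ} (hm : Odd m) {b : C}
    (hb : b ∈ shiftGr C m k) : degreeInvolution C b = -((-1 : ℚ) ^ k • b) := by
  obtain rfl | ⟨j, rfl, hj⟩ := eq_zero_or_of_mem_shiftGr hb
  · simp
  · rw [degreeInvolution_of_mem hj, pow_add, hm.neg_one_pow]
    simp

theorem Dd_mem_shiftGr {m k : ℕ} {b : C} (hb : b ∈ shiftGr C m k) :
    Dd C b ∈ shiftGr C m (k + 1) := by
  obtain rfl | ⟨j, rfl, hj⟩ := eq_zero_or_of_mem_shiftGr hb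
  · simp
  · rw [add_right_comm]
    exact mem_shiftGr_add (Dd_mem hj)

theorem mul_mem_shiftGr {m i k : ℕ} {a b : C} (ha : a ∈ Gr C i) (hb : b ∈ shiftGr C m k) :
    a * b ∈ shiftGr C m (i + k) := by
  obtain rfl | ⟨j, rfl, hj⟩ := eq_zero_or_of_mem_shiftGr hb
  · simp
  · rw [← add_assoc]
    exact mem_shiftGr_add (mul_mem_Gr ha hj)

theorem shiftGr_mul_mem {m i k : ℕ} {a b : C} (ha : a ∈ Gr C i) (hb : b ∈ shiftGr C m k) :
    b * a ∈ shiftGr C m (k + i) := by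
  obtain rfl | ⟨j, rfl, hj⟩ := eq_zero_or_of_mem_shiftGr hb
  · simp
  · rw [add_right_comm]
    exact mem_shiftGr_add (mul_mem_Gr hj ha)

theorem mul_comm_of_mem_shiftGr {m i k : ℕ} (hm : Odd m) {a b : C} (ha : a ∈ Gr C i)
    (hb : b ∈ shiftGr C m k) : a * b = ((-1 : ℚ) ^ (i * k + i)) • (b * a) := by
  obtain rfl | ⟨j, rfl, hj⟩ := eq_zero_or_of_mem_shiftGr hb
  · simp
  · rw [mul_comm_of_mem ha hj]
    congr 1
    obtain ⟨t, rfl⟩ := hm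
    rw [show i * (j + (2 * t + 1)) + i = i * j + 2 * (i * t + i) by ring, pow_add _ (i * j)]
    simp

/-- The grading of `C ⊗ Λu`, where `u` has degree `m`. -/
def grading (C : Type) [GCDGA C] (m k : ℕ) : Submodule ℚ (AdjoinOdd C) :=
  ((Gr C k).prod (shiftGr C m k)).comap (toProd C)

theorem mem_grading {m k : ℕ} {x : AdjoinOdd C} :
    x ∈ grading C m k ↔ x.fst ∈ Gr C k ∧ x.snd ∈ shiftGr C m k := Iff.rfl

theorem iSupIndep_grading (m : ℕ) : iSupIndep (grading C m) := by
  refine iSupIndep_of_projections (N := C × C) _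
    (fun k => (LinearMap.prodMap (GradedAlgebra.proj (Gr C) k)
      (if m ≤ k then GradedAlgebra.proj (Gr C) (k - m) else 0)).comp (toProd C)) ?_ ?_
  · rintro k ⟨a, b⟩ hab h
    obtain ⟨ha, hb⟩ := mem_grading.1 hab
    obtain ⟨h₁, h₂⟩ := Prod.ext_iff.1 h
    simp only [toProd, LinearMap.comp_apply, LinearMap.coe_mk, AddHom.coe_mk,
      LinearMap.prodMap_apply, GradedAlgebra.proj_apply, Prod.fst_zero, Prod.snd_zero]
      at h₁ h₂ ha hb
    rw [DirectSum.decompose_of_mem_same _ ha] at h₁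
    refine AdjoinOdd.ext h₁ ?_
    obtain rfl | ⟨j, rfl, hj⟩ := eq_zero_or_of_mem_shiftGr hb
    · rfl
    · rw [if_pos (Nat.le_add_left m j), Nat.add_sub_cancel, GradedAlgebra.proj_apply,
        DirectSum.decompose_of_mem_same _ hj] at h₂
      exact h₂
  · rintro k l hl ⟨a, b⟩ hab
    obtain ⟨ha, hb⟩ := mem_grading.1 hab
    refine Prod.ext (DirectSum.decompose_of_mem_ne _ ha hl) ?_
    simp only [toProd, LinearMap.comp_apply, LinearMap.coe_mk, AddHom.coe_mk,
      LinearMap.prodMap_apply, Prod.snd_zero] at hb ⊢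
    obtain rfl | ⟨j, rfl, hj⟩ := eq_zero_or_of_mem_shiftGr hb
    · exact map_zero _
    · split_ifs with h
      · exact DirectSum.decompose_of_mem_ne _ hj (by omega)
      · rfl

theorem iSup_grading (m : ℕ) : ⨆ k, grading C m k = ⊤ := by
  rw [eq_top_iff]
  rintro ⟨a, b⟩ -
  have ha : (⟨a, 0⟩ : AdjoinOdd C) ∈ ⨆ k, grading C m k :=
    induction_Gr (P := fun a => (⟨a, 0⟩ : AdjoinOdd C) ∈ ⨆ k, grading C m k)
      (fun i a ha => Submodule.mem_iSup_of_mem i (mem_grading.2 ⟨ha, zero_mem _⟩))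
      (fun a a' h h' => by
        have := add_mem h h'
        rwa [show (⟨a, 0⟩ : AdjoinOdd C) + ⟨a', 0⟩ = ⟨a + a', 0⟩ by ext <;> simp] at this) a
  have hb : (⟨0, b⟩ : AdjoinOdd C) ∈ ⨆ k, grading C m k :=
    induction_Gr (P := fun b => (⟨0, b⟩ : AdjoinOdd C) ∈ ⨆ k, grading C m k)
      (fun i b hb => Submodule.mem_iSup_of_mem (i + m)
        (mem_grading.2 ⟨zero_mem _, mem_shiftGr_add hb⟩))
      (fun b b' h h' => by
        have := add_mem h h'
        rwa [show (⟨0, b⟩ : AdjoinOdd C) + ⟨0, b'⟩ = ⟨0, b + b'⟩ by ext <;> simp] at this) b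
  have := add_mem ha hb
  rwa [show (⟨a, 0⟩ : AdjoinOdd C) + ⟨0, b⟩ = ⟨a, b⟩ by ext <;> simp] at this

/-- The differential of `C ⊗ Λu` with `du = w`. -/
def diff (w : C) : AdjoinOdd C →ₗ[ℚ] AdjoinOdd C where
  toFun x := ⟨Dd C x.fst + degreeInvolution C x.snd * w, Dd C x.snd⟩
  map_add' x y := by
    ext
    · simp only [add_fst, add_snd, map_add, add_mul]
      abel
    · simp
  map_smul' c x := by ext <;> simp

@[simp] theorem diff_fst (w : C) (x : AdjoinOdd C) :
    (diff w x).fst = Dd C x.fst + degreeInvolution C x.snd * w := rfl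
@[simp] theorem diff_snd (w : C) (x : AdjoinOdd C) : (diff w x).snd = Dd C x.snd := rfl

theorem mul_comm_of_even {j : ℕ} (hj : Even j) {w : C} (hw : w ∈ Gr C j) (a : C) :
    w * a = a * w := by
  refine induction_Gr (P := fun a => w * a = a * w) (fun i a ha => ?_)
    (fun x y hx hy => by simp only [mul_add, add_mul, hx, hy]) a
  rw [mul_comm_of_mem hw ha, (hj.mul_right i).neg_one_pow, one_smul]

theorem diff_leibniz {m : ℕ} (hm : Odd m) {w : C} (hw : w ∈ Gr C (m + 1)) {i : ℕ}
    {x : AdjoinOdd C} (y : AdjoinOdd C) (hx : x ∈ grading C m i) :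
    diff w (x * y) = diff w x * y + ((-1 : ℚ) ^ i) • (x * diff w y) := by
  obtain ⟨a, b⟩ := x
  obtain ⟨a', b'⟩ := y
  obtain ⟨ha, hb⟩ := mem_grading.1 hx
  simp only at ha hb
  have hww := mul_comm_of_even hm.add_one hw
  have hσw : degreeInvolution C w = w := by
    rw [degreeInvolution_of_mem hw, hm.add_one.neg_one_pow, one_smul]
  have hbσ := degreeInvolution_of_mem_shiftGr hm hb
  have hdb : ∀ c, Dd C (b * c) = Dd C b * c - ((-1 : ℚ) ^ i) • (b * Dd C c) := by
    intro c
    obtain rfl | ⟨j, rfl, hj⟩ := eq_zero_or_of_mem_shiftGr hb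
    · simp
    · rw [Dd_leibniz _ hj, pow_add, hm.neg_one_pow]
      simp
  refine AdjoinOdd.ext ?_ ?_
  · simp only [diff_fst, mul_fst, mul_snd, add_fst, smul_fst]
    rw [Dd_leibniz _ ha, map_add, degreeInvolution_mul, degreeInvolution_mul,
      degreeInvolution_degreeInvolution, degreeInvolution_of_mem ha]
    simp only [add_mul, mul_add, smul_add, mul_assoc, hww, smul_mul_assoc]
    abel
  · simp only [diff_fst, diff_snd, mul_snd, add_snd, smul_snd]
    rw [map_add, Dd_leibniz _ ha, hdb, Dd_degreeInvolution, hbσ, map_add,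
      degreeInvolution_mul, degreeInvolution_degreeInvolution, hσw]
    simp only [add_mul, mul_add, smul_add, mul_assoc, hww, smul_mul_assoc, neg_mul, mul_neg,
      smul_neg]
    abel

/-- The gcdga `C ⊗ Λu` with `u` of odd degree `m` and `du = w`. -/
@[reducible] def gcdga {m : ℕ} (hm : Odd m) {w : C} (hw : w ∈ Gr C (m + 1))
    (hdw : Dd C w = 0) : GCDGA (AdjoinOdd C) :=
  { (inferInstance : Ring (AdjoinOdd C)), (inferInstance : Algebra ℚ (AdjoinOdd C)) with
    grading := grading C m
    gradedAlgebra := by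
      refine gradedAlgebraOfIndep _ ⟨one_mem_Gr, zero_mem _⟩ ?_ (iSupIndep_grading m)
        (iSup_grading m)
      intro i j a b hai hbj
      obtain ⟨ha, ha'⟩ := mem_grading.1 hai
      obtain ⟨hb, hb'⟩ := mem_grading.1 hbj
      refine ⟨mul_mem_Gr ha hb, add_mem (mul_mem_shiftGr ha hb') ?_⟩
      refine shiftGr_mul_mem ?_ ha'
      rw [degreeInvolution_of_mem hb]
      exact Submodule.smul_mem _ _ hb
    grading_comm := by
      intro i j a b hai hbj
      obtain ⟨ha, ha'⟩ := mem_grading.1 hai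
      obtain ⟨hb, hb'⟩ := mem_grading.1 hbj
      refine AdjoinOdd.ext (mul_comm_of_mem ha hb) ?_
      simp only [mul_snd, smul_snd]
      rw [mul_comm_of_mem_shiftGr hm ha hb', mul_comm_of_mem_shiftGr hm hb ha',
        degreeInvolution_of_mem ha, degreeInvolution_of_mem hb, smul_add, smul_smul,
        mul_smul_comm, mul_smul_comm, smul_smul, ← pow_add, ← pow_add, add_comm]
      congr 2
      rw [show i * j + (j * i + j) = 2 * (i * j) + j by ring, pow_add, pow_mul]
      simp
    d := diff w
    d_sq := by
      intro a
      refine AdjoinOdd.ext ?_ (by simp [Dd_Dd])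
      have h : ∀ c : C, Dd C (c * w) = Dd C c * w := by
        intro c
        refine induction_Gr (P := fun c => Dd C (c * w) = Dd C c * w) (fun i c hc => ?_)
          (fun x y hx hy => by simp only [add_mul, map_add, hx, hy]) c
        rw [Dd_leibniz _ hc, hdw, mul_zero, smul_zero, add_zero]
      simp [Dd_Dd, h, Dd_degreeInvolution]
    d_grading := by
      intro i a hai
      obtain ⟨ha, ha'⟩ := mem_grading.1 hai
      refine ⟨add_mem (Dd_mem ha) ?_, Dd_mem_shiftGr ha'⟩
      rw [degreeInvolution_of_mem_shiftGr hm ha']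
      obtain h | ⟨j, rfl, hj⟩ := eq_zero_or_of_mem_shiftGr ha'
      · simp [h]
      · rw [neg_mul, smul_mul_assoc, add_assoc]
        exact neg_mem (Submodule.smul_mem _ _ (mul_mem_Gr hj hw))
    d_leibniz := fun i a b ha => diff_leibniz hm hw b ha }

/-- The inclusion of `C` in `C ⊗ Λu`. -/
def inl (C : Type) [GCDGA C] : C →ₐ[ℚ] AdjoinOdd C :=
  AlgHom.ofLinearMap
    { toFun := fun a => ⟨a, 0⟩
      map_add' := fun x y => by ext <;> simp
      map_smul' := fun c x => by ext <;> simp }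
    rfl (fun x y => by ext <;> simp)

end AdjoinOdd

theorem OddExtension.incl_eq_zero {A E : Type} [GCDGA A] [GCDGA E] (ext : OddExtension A E)
    {a b : A} (h : ext.incl a + ext.incl b * ext.u = 0) :
    ext.incl a = 0 ∧ ext.incl b = 0 := by
  let _ : GCDGA (AdjoinOdd E) := AdjoinOdd.gcdga ext.u_odd (Dd_mem ext.u_mem) (Dd_Dd _)
  have hf : IsDGAHom ((AdjoinOdd.inl E).comp ext.incl) := by
    refine ⟨fun x => AdjoinOdd.ext ?_ ?_, fun i x hx => ⟨ext.incl_dga.2 i x hx, zero_mem _⟩⟩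
    · change ext.incl (Dd A x) = Dd E (ext.incl x) + degreeInvolution E 0 * _
      rw [map_zero, zero_mul, add_zero, ext.incl_dga.1]
    · exact (map_zero (Dd E)).symm
  obtain ⟨g, ⟨-, hgi, hgu⟩, -⟩ := ext.free (AdjoinOdd E) ((AdjoinOdd.inl E).comp ext.incl) hf
    ⟨0, 1⟩
    ⟨zero_mem _, by
      have := AdjoinOdd.mem_shiftGr_add (m := ext.udeg) (one_mem_Gr (T := E))
      rwa [zero_add] at this⟩
    (by
      refine AdjoinOdd.ext ?_ Dd_one
      change Dd E 0 + degreeInvolution E 1 * Dd E ext.u = ext.incl ext.du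
      rw [map_zero, zero_add, degreeInvolution_one, one_mul, ext.hdu])
  have hi : ∀ x, g (ext.incl x) = AdjoinOdd.inl E (ext.incl x) := DFunLike.congr_fun hgi
  have h' := congrArg g h
  rw [map_add, map_mul, hi, hi, hgu, map_zero] at h'
  constructor
  · have h₁ : ext.incl a + ext.incl b * 0 = 0 := congrArg AdjoinOdd.fst h'
    simpa using h₁
  · have h₂ : 0 + (ext.incl b * 1 + 0 * degreeInvolution E 0) = 0 := congrArg AdjoinOdd.snd h'
    simpa using h₂

end ExteriorAdjunction

section Kernel

theorem TensorPower.isDGAHom_mu {A T : Type} [GCDGA A] [GCDGA T] {r : ℕ}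
    (P : TensorPower A r T) : IsDGAHom P.mu :=
  (P.coprod A (fun _ => AlgHom.id ℚ A) (fun _ => isDGAHom_id A)).choose_spec.1.1

theorem TensorPower.mu_ι {A T : Type} [GCDGA A] [GCDGA T] {r : ℕ}
    (P : TensorPower A r T) (k : Fin r) (a : A) : P.mu (P.ι k a) = a :=
  DFunLike.congr_fun
    ((P.coprod A (fun _ => AlgHom.id ℚ A) (fun _ => isDGAHom_id A)).choose_spec.1.2 k) a

/-- In a semiring, a sum of commuting elements of square zero is nilpotent. -/
theorem sum_pow_card_succ_eq_zero {R ι : Type*} [Semiring R] (s : Finset ι) (x : ι → R)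
    (hc : ∀ i j, Commute (x i) (x j)) (hx : ∀ i, x i ^ 2 = 0) :
    (∑ i ∈ s, x i) ^ (s.card + 1) = 0 := by
  classical
  induction s using Finset.induction_on with
  | empty => simp
  | insert i s hi ih =>
    rw [Finset.sum_insert hi, Finset.card_insert_of_notMem hi]
    exact (Commute.sum_right _ _ _ fun j _ => hc i j).add_pow_eq_zero_of_add_le_succ_of_pow_eq_zero
      (hx i) ih (by omega)

theorem pow_le_pow_mul_top_of_le_add_mul_top {T : Type} [Ring T] [Algebra ℚ T]
    {I K L : Submodule ℚ T} (hI : I ≤ (K + L) * ⊤) (hKL : Commute K L) (hK : Commute K ⊤)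
    (hL : Commute L ⊤) {r : ℕ} (hLr : L ^ r = 0) (n : ℕ) :
    I ^ (n + r) ≤ K ^ (n + 1) * ⊤ := by
  refine (pow_le_pow_left' hI _).trans ?_
  rw [(hK.add_left hL).mul_pow, hKL.add_pow, Finset.sum_mul]
  refine Finset.sum_induction _ (fun S => S ≤ K ^ (n + 1) * ⊤) (fun _ _ => sup_le) bot_le ?_
  intro m _
  by_cases hmn : n + 1 ≤ m
  · obtain ⟨t, rfl⟩ := Nat.exists_eq_add_of_le hmn
    rw [pow_add, mul_assoc, mul_assoc, mul_assoc]
    exact mul_le_mul' le_rfl le_top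
  · have hz : L ^ (n + r - m) = 0 := pow_eq_zero_of_le (by omega) hLr
    rw [hz, mul_zero, zero_mul, zero_mul]
    exact bot_le

variable {A E : Type} [GCDGA A] [GCDGA E] (ext : OddExtension A E) {r : ℕ}
  {TA TE : Type} [GCDGA TA] [GCDGA TE] (PA : TensorPower A r TA) (PE : TensorPower E r TE)

/-- The difference of the `k`-th and the `i`-th copy of `u`. -/
def TensorPower.oddDiff (i k : Fin r) : TE := PE.ι k ext.u - PE.ι i ext.u

/-- The span of the differences of the `i`-th copy of `u` with the other copies. -/
def TensorPower.oddDiffSpan (i : Fin r) : Submodule ℚ TE :=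
  ∑ k ∈ Finset.univ.erase i, Submodule.span ℚ {PE.oddDiff ext i k}

theorem TensorPower.oddDiff_mem_Gr (i k : Fin r) : PE.oddDiff ext i k ∈ Gr TE ext.udeg :=
  sub_mem ((PE.ι_dga k).2 _ _ ext.u_mem) ((PE.ι_dga i).2 _ _ ext.u_mem)

theorem isHomogeneousSubmodule_span_singleton {i : ℕ} {x : TE} (hx : x ∈ Gr TE i) :
    IsHomogeneousSubmodule (Submodule.span ℚ {x}) :=
  isHomogeneousSubmodule_span fun y hy => ⟨i, by rwa [Set.mem_singleton_iff.1 hy]⟩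

theorem TensorPower.oddDiffSpan_commute (i : Fin r) {P : Submodule ℚ TE}
    (hP : IsHomogeneousSubmodule P) : Commute (PE.oddDiffSpan ext i) P :=
  Commute.sum_left _ _ _ fun k _ =>
    (isHomogeneousSubmodule_span_singleton (PE.oddDiff_mem_Gr ext i k)).commute hP

theorem TensorPower.oddDiffSpan_pow (i : Fin r) : PE.oddDiffSpan ext i ^ r = 0 := by
  have hcard : (Finset.univ.erase i).card + 1 = r := by
    rw [Finset.card_erase_add_one (Finset.mem_univ i), Finset.card_fin]
  have h := sum_pow_card_succ_eq_zero (Finset.univ.erase i)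
    (fun k => Submodule.span ℚ {PE.oddDiff ext i k})
    (fun k l => (isHomogeneousSubmodule_span_singleton (PE.oddDiff_mem_Gr ext i k)).commute
      (isHomogeneousSubmodule_span_singleton (PE.oddDiff_mem_Gr ext i l)))
    (fun k => by
      rw [pow_two, Submodule.span_mul_span, Set.singleton_mul_singleton,
        mul_self_eq_zero_of_odd ext.u_odd (PE.oddDiff_mem_Gr ext i k),
        Submodule.span_zero_singleton, Submodule.zero_eq_bot])
  rwa [hcard] at h

theorem TensorPower.oddDiffSpan_mul_top_le_ker (i : Fin r) :
    PE.oddDiffSpan ext i * ⊤ ≤ LinearMap.ker PE.mu.toLinearMap := by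
  have h : PE.oddDiffSpan ext i ≤ LinearMap.ker PE.mu.toLinearMap := by
    refine Finset.sum_induction _ (fun S => S ≤ LinearMap.ker PE.mu.toLinearMap)
      (fun _ _ => sup_le) bot_le fun k _ => ?_
    rw [Submodule.span_singleton_le_iff_mem, LinearMap.mem_ker, TensorPower.oddDiff]
    simp [PE.mu_ι]
  refine Submodule.mul_le.2 fun x hx y _ => ?_
  have hx0 : PE.mu x = 0 := h hx
  rw [LinearMap.mem_ker, AlgHom.toLinearMap_apply, map_mul, hx0, zero_mul]

variable {PA PE} {φ : TA →ₐ[ℚ] TE}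

/-- Modulo the differences of copies of `u`, every element has the form `a + b u`. -/
theorem TensorPower.exists_eq_add_mul_add (hφ : IsDGAHom φ)
    (hφι : ∀ k, φ.comp (PA.ι k) = (PE.ι k).comp ext.incl) (i : Fin r) (x : TE) :
    ∃ a b, ∃ l ∈ PE.oddDiffSpan ext i * (⊤ : Submodule ℚ TE),
      x = φ a + φ b * PE.ι i ext.u + l := by
  set L := PE.oddDiffSpan ext i
  set R : Submodule ℚ TE := Submodule.map φ.toLinearMap ⊤ with hR
  set U : Submodule ℚ TE := Submodule.span ℚ {PE.ι i ext.u} with hU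
  have hu : PE.ι i ext.u ∈ Gr TE ext.udeg := (PE.ι_dga i).2 _ _ ext.u_mem
  have hLt : Commute L ⊤ := PE.oddDiffSpan_commute ext i IsHomogeneousSubmodule.top
  have hUR : Commute U R := (isHomogeneousSubmodule_span_singleton hu).commute
    (IsHomogeneousSubmodule.top.map hφ)
  have hUU : U * U = 0 := by
    rw [hU, Submodule.span_mul_span, Set.singleton_mul_singleton,
      mul_self_eq_zero_of_odd ext.u_odd hu, Submodule.span_zero_singleton,
      Submodule.zero_eq_bot]
  have hRR : R * R ≤ R := by
    rw [hR, ← Submodule.map_mul]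
    exact Submodule.map_mono le_top
  have h1R : (1 : TE) ∈ R := ⟨1, trivial, map_one φ⟩
  have hRle : R ≤ R + R * U := le_sup_left
  have hRUle : R * U ≤ R + R * U := le_sup_right
  have hPP : (R + R * U) * (R + R * U) ≤ R + R * U := by
    rw [add_mul, mul_add, mul_add]
    refine sup_le (sup_le (hRR.trans hRle) ?_) (sup_le ?_ ?_)
    · rw [← mul_assoc]
      exact (mul_le_mul' hRR le_rfl).trans hRUle
    · rw [mul_assoc, hUR.eq, ← mul_assoc]
      exact (mul_le_mul' hRR le_rfl).trans hRUle
    · rw [mul_assoc, ← mul_assoc U, hUR.eq, mul_assoc R U, hUU, mul_zero, mul_zero]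
      exact bot_le
  have hPle : R + R * U ≤ R + R * U + L * ⊤ := le_sup_left
  have hLle : L * ⊤ ≤ R + R * U + L * ⊤ := le_sup_right
  have hMM : (R + R * U + L * ⊤) * (R + R * U + L * ⊤) ≤ R + R * U + L * ⊤ := by
    rw [add_mul _ (L * ⊤), mul_add (R + R * U) _ (L * ⊤)]
    refine sup_le (sup_le (hPP.trans hPle) (le_trans ?_ hLle)) (le_trans ?_ hLle)
    · refine (mul_le_mul' le_top le_rfl).trans ?_
      rw [← mul_assoc, ← hLt.eq, mul_assoc]
      exact mul_le_mul' le_rfl le_top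
    · rw [mul_assoc]
      exact mul_le_mul' le_rfl le_top
  let S : Subalgebra ℚ TE := (R + R * U + L * ⊤).toSubalgebra (hPle (hRle h1R))
    fun x y hx hy => hMM (Submodule.mul_mem_mul hx hy)
  have hS : S = ⊤ := by
    refine PE.eq_top_of_range_le S fun k e => ?_
    have hk : S.comap (PE.ι k) = ⊤ := by
      refine ext.eq_top_of_mem _ (fun a => ?_) ?_
      · have h : PE.ι k (ext.incl a) = φ (PA.ι k a) :=
          (DFunLike.congr_fun (hφι k) a).symm
        change PE.ι k (ext.incl a) ∈ R + R * U + L * ⊤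
        rw [h]
        exact hPle (hRle ⟨_, trivial, rfl⟩)
      · have hui : PE.ι i ext.u ∈ R + R * U + L * ⊤ := by
          have := Submodule.mul_mem_mul h1R (Submodule.mem_span_singleton_self (R := ℚ)
            (PE.ι i ext.u))
          rw [one_mul] at this
          exact hPle (hRUle this)
        change PE.ι k ext.u ∈ R + R * U + L * ⊤
        by_cases hki : k = i
        · rwa [hki]
        · have hv : PE.oddDiff ext i k ∈ L :=
            Finset.single_le_sum_of_canonicallyOrdered
              (f := fun k => Submodule.span ℚ {PE.oddDiff ext i k})
              (Finset.mem_erase.2 ⟨hki, Finset.mem_univ k⟩)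
              (Submodule.mem_span_singleton_self _)
          have hv' := Submodule.mul_mem_mul hv (Submodule.mem_top (R := ℚ) (x := (1 : TE)))
          rw [mul_one] at hv'
          have := add_mem hui (hLle hv')
          rwa [TensorPower.oddDiff, add_sub_cancel] at this
    have : e ∈ S.comap (PE.ι k) := by rw [hk]; trivial
    exact this
  have hx : x ∈ R + R * U + L * ⊤ := by
    change x ∈ S
    rw [hS]
    trivial
  obtain ⟨p, hp, l, hl, rfl⟩ := Submodule.mem_sup.1 hx
  obtain ⟨_, ⟨a, -, rfl⟩, q, hq, rfl⟩ := Submodule.mem_sup.1 hp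
  obtain ⟨_, ⟨b, -, rfl⟩, rfl⟩ := Submodule.mem_mul_span_singleton.1 hq
  exact ⟨a, b, l, hl, rfl⟩

theorem TensorPower.mu_comp (hφ : IsDGAHom φ)
    (hφι : ∀ k, φ.comp (PA.ι k) = (PE.ι k).comp ext.incl) (a : TA) :
    PE.mu (φ a) = ext.incl (PA.mu a) := by
  have h := (PA.coprod E (fun _ => ext.incl) (fun _ => ext.incl_dga)).unique
    (y₁ := PE.mu.comp φ) (y₂ := ext.incl.comp PA.mu)
    ⟨PE.isDGAHom_mu.comp hφ, fun k => by
      rw [AlgHom.comp_assoc, hφι]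
      ext a
      exact PE.mu_ι k _⟩
    ⟨ext.incl_dga.comp PA.isDGAHom_mu, fun k => by
      ext a
      exact congrArg ext.incl (PA.mu_ι k a)⟩
  exact DFunLike.congr_fun h a

theorem TensorPower.map_mem_map_ker
    (hφι : ∀ k, φ.comp (PA.ι k) = (PE.ι k).comp ext.incl) (i : Fin r) {a : TA}
    (ha : ext.incl (PA.mu a) = 0) :
    φ a ∈ Submodule.map φ.toLinearMap (LinearMap.ker PA.mu.toLinearMap) := by
  refine ⟨a - PA.ι i (PA.mu a), ?_, ?_⟩
  · simp [PA.mu_ι]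
  · have h : φ (PA.ι i (PA.mu a)) = PE.ι i (ext.incl (PA.mu a)) :=
      DFunLike.congr_fun (hφι i) _
    rw [AlgHom.toLinearMap_apply, map_sub, h, ha, map_zero, sub_zero]

/-- The kernel of the multiplication of `ΛV ⊗ Λu` is generated by that of `ΛV` and the
differences of copies of `u`. -/
theorem TensorPower.ker_mu_le (hφ : IsDGAHom φ)
    (hφι : ∀ k, φ.comp (PA.ι k) = (PE.ι k).comp ext.incl) (i : Fin r) :
    LinearMap.ker PE.mu.toLinearMap ≤
      (Submodule.map φ.toLinearMap (LinearMap.ker PA.mu.toLinearMap) +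
        PE.oddDiffSpan ext i) * ⊤ := by
  intro x hx
  obtain ⟨a, b, l, hl, rfl⟩ := TensorPower.exists_eq_add_mul_add ext hφ hφι i x
  have hl0 : PE.mu l = 0 := PE.oddDiffSpan_mul_top_le_ker ext i hl
  have hx0 : PE.mu (φ a + φ b * PE.ι i ext.u + l) = 0 := hx
  rw [map_add, hl0, add_zero, map_add, map_mul, PE.mu_ι, mu_comp ext hφ hφι,
    mu_comp ext hφ hφι] at hx0
  obtain ⟨ha, hb⟩ := ext.incl_eq_zero hx0
  have ha' := map_mem_map_ker ext hφι i ha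
  have hb' := map_mem_map_ker ext hφι i hb
  rw [add_mul]
  refine Submodule.add_mem_sup (add_mem ?_ ?_) hl
  · simpa using Submodule.mul_mem_mul ha' (Submodule.mem_top (R := ℚ) (x := (1 : TE)))
  · exact Submodule.mul_mem_mul hb' Submodule.mem_top

end Kernel

/-- Let `(ΛV,d)` be a minimal Sullivan model and `u` an odd
generator with `du ∈ ΛV`, and let `n ≥ 0`, `r ≥ 2`.  Inside
`(ΛV ⊗ Λu)^{⊗r}` (identified with `(ΛV)^{⊗r} ⊗ (Λu)^{⊗r}` via the morphism
`φ : (ΛV)^{⊗r} → (ΛV ⊗ Λu)^{⊗r}` induced by the inclusion `ΛV → ΛV ⊗ Λu`) one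
has the inclusion of ideals
`(ker μ^r_{ΛV⊗Λu})^{n+r} ⊆ (ker μ^r_{ΛV})^{n+1} · (ΛV ⊗ Λu)^{⊗r}`. -/
theorem ker_mu_pow_oddExtension_le (A : Type) [GCDGA A] (S : MinimalSullivan A)
    (E : Type) [GCDGA E] (ext : OddExtension A E) (n r : ℕ) (hr : 2 ≤ r)
    (TA TE : Type) [GCDGA TA] [GCDGA TE]
    (PA : TensorPower A r TA) (PE : TensorPower E r TE)
    (φ : TA →ₐ[ℚ] TE) (hφ : IsDGAHom φ)
    (hφι : ∀ k, φ.comp (PA.ι k) = (PE.ι k).comp ext.incl) :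
    (LinearMap.ker PE.mu.toLinearMap) ^ (n + r) ≤
      Submodule.map φ.toLinearMap ((LinearMap.ker PA.mu.toLinearMap) ^ (n + 1)) *
        (⊤ : Submodule ℚ TE) := by
  let i : Fin r := ⟨0, by omega⟩
  have hK := (PA.isDGAHom_mu.isHomogeneousSubmodule_ker).map hφ
  rw [Submodule.map_pow]
  exact pow_le_pow_mul_top_of_le_add_mul_top (TensorPower.ker_mu_le ext hφ hφι i)
    (PE.oddDiffSpan_commute ext i hK).symm (hK.commute IsHomogeneousSubmodule.top)
    (PE.oddDiffSpan_commute ext i IsHomogeneousSubmodule.top) (PE.oddDiffSpan_pow ext i) n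

end RHT
end
end

section
/- Let (ΛV,d) be a pure coformal minimal Sullivan model with V^{even} = span(x₁,…,x_n), V^{odd} = span(y₁,…,y_m), and for each j write dy_j = Σ_k α^j_k x_k² + Σ_{p<q} β^j_{p,q} x_p x_q. In the cdga ΛV ⊗ Λ X̄ ⊗ ΛV' ⊗ Λ X̄' (where ΛV' is a copy of ΛV, X̄ = sX is the suspension of X = V^{even} with d x̄ = dx = 0), set φ_j = Σ_k α^j_k (x_k − x'_k)(x̄_k + x̄'_k) + (1/2) Σ_{p<q} β^j_{p,q} (x_p − x'_p)(x̄_q + x̄'_q) + (1/2) Σ_{p<q} β^j_{p,q} (x_q − x'_q)(x̄_p + x̄'_p). Then each element y_j − y'_j − φ_j (j = 1,…,m) is a cocycle. -/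
noncomputable section

namespace RHT

/-- The element
`φ_j = Σ_k α^j_k (x_k − x'_k)(x̄_k + x̄'_k)
  + ½ Σ_{p<q} β^j_{p,q} (x_p − x'_p)(x̄_q + x̄'_q)
  + ½ Σ_{p<q} β^j_{p,q} (x_q − x'_q)(x̄_p + x̄'_p)`
of `ΛV ⊗ ΛX̄ ⊗ ΛV' ⊗ ΛX̄'`, where `ι₁, ι₂` are the two copies of `ΛV` (so
`v = ι₁ v` and `v' = ι₂ v`) and `xb, xb'` are the suspension generators. -/
def phiElt {A C : Type} [GCDGA A] [GCDGA C] {n m : ℕ} (x : Fin n → A)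
    (α : Fin m → Fin n → ℚ) (β : Fin m → Fin n → Fin n → ℚ)
    (ι₁ ι₂ : A →ₐ[ℚ] C) (xb xb' : Fin n → C) (j : Fin m) : C :=
  (∑ k, α j k • ((ι₁ (x k) - ι₂ (x k)) * (xb k + xb' k))) +
    (1 / 2 : ℚ) •
      (∑ p, ∑ q, if p < q then
        β j p q • ((ι₁ (x p) - ι₂ (x p)) * (xb q + xb' q)) else 0) +
    (1 / 2 : ℚ) •
      (∑ p, ∑ q, if p < q then
        β j p q • ((ι₁ (x q) - ι₂ (x q)) * (xb p + xb' p)) else 0)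

/-- Homogeneous elements of even degree are central. -/
theorem mul_comm_of_mem_Gr_even {C : Type} [GCDGA C] {i j : ℕ} (hi : Even i) {a b : C}
    (ha : a ∈ Gr C i) (hb : b ∈ Gr C j) : a * b = b * a := by
  have h := GCDGA.grading_comm i j a b ha hb
  rwa [(hi.mul_right j).neg_one_pow, one_smul] at h

/-- The differential is linear over cocycles of even degree. -/
theorem Dd_mul_of_even_cocycle {C : Type} [GCDGA C] {i : ℕ} (hi : Even i) {a : C}
    (ha : a ∈ Gr C i) (hda : Dd C a = 0) (b : C) : Dd C (a * b) = a * Dd C b := by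
  have h : Dd C (a * b) = Dd C a * b + ((-1 : ℚ) ^ i) • (a * Dd C b) :=
    GCDGA.d_leibniz i a b ha
  rwa [hda, zero_mul, zero_add, hi.neg_one_pow, one_smul] at h

theorem sub_mul_add_add_sub_mul_add {C : Type} [Ring C] {a a' b b' : C}
    (hab : a * b = b * a) (hab' : a * b' = b' * a) (ha'b : a' * b = b * a')
    (ha'b' : a' * b' = b' * a') :
    (a - a') * (b + b') + (b - b') * (a + a') = 2 * (a * b - a' * b') := by
  have h : (a - a') * (b + b') + (b - b') * (a + a') =
      (a * b + b * a) + (a * b' - b' * a) - (a' * b - b * a') - (a' * b' + b' * a') := by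
    noncomm_ring
  rw [h, hab', ha'b, ← hab, ← ha'b']
  noncomm_ring

/-- With the notation above (a pure coformal minimal Sullivan
model `(ΛV,d)`, `dy_j = Σ_k α^j_k x_k² + Σ_{p<q} β^j_{p,q} x_p x_q`, and the
cdga `ΛV ⊗ ΛX̄ ⊗ ΛV' ⊗ ΛX̄'`), each element `y_j − y'_j − φ_j` is a
cocycle. -/
theorem y_sub_y'_sub_phi_isCocycle
    -- `(ΛV,d)`: a pure coformal minimal Sullivan model
    (A : Type) [GCDGA A] (S : MinimalSullivan A)
    (hpure : S.Pure) (hcof : S.Coformal)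
    -- a homogeneous basis `x₁,…,x_n` of `X = V^even`, with `x i` of degree `e i`
    {n : ℕ} (x : Fin n → A) (e : Fin n → ℕ)
    (he_even : ∀ i, Even (e i)) (hx_mem : ∀ i, x i ∈ S.V (e i))
    (hx_li : LinearIndependent ℚ x)
    (hx_span : Submodule.span ℚ (Set.range x) = S.Veven)
    -- a homogeneous basis `y₁,…,y_m` of `Y = V^odd`, with `y j` of degree `o j`
    {m : ℕ} (y : Fin m → A) (o : Fin m → ℕ)
    (ho_odd : ∀ j, Odd (o j)) (hy_mem : ∀ j, y j ∈ S.V (o j))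
    (hy_li : LinearIndependent ℚ y)
    (hy_span : Submodule.span ℚ (Set.range y) = S.Vodd)
    -- the structure constants: `dy_j = Σ_k α^j_k x_k² + Σ_{p<q} β^j_{p,q} x_p x_q`
    (α : Fin m → Fin n → ℚ) (β : Fin m → Fin n → Fin n → ℚ)
    (hdy : ∀ j, Dd A (y j) =
      (∑ k, α j k • (x k ^ 2)) +
        ∑ p, ∑ q, if p < q then β j p q • (x p * x q) else 0)
    -- the cdga `C = ΛV ⊗ ΛX̄ ⊗ ΛV' ⊗ ΛX̄'`: two copies `ι₁, ι₂` of `ΛV` and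
    -- the suspension generators `x̄_k = xb k`, `x̄'_k = xb' k` of degree `|x_k| − 1`
    -- with `d x̄_k = x_k` and `d x̄'_k = x'_k`
    (C : Type) [GCDGA C] (ι₁ ι₂ : A →ₐ[ℚ] C)
    (hι₁ : IsDGAHom ι₁) (hι₂ : IsDGAHom ι₂)
    (xb xb' : Fin n → C)
    (hxb_mem : ∀ i, xb i ∈ Gr C (e i - 1)) (hxb'_mem : ∀ i, xb' i ∈ Gr C (e i - 1))
    (hdxb : ∀ i, Dd C (xb i) = ι₁ (x i)) (hdxb' : ∀ i, Dd C (xb' i) = ι₂ (x i)) :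
    ∀ j, Dd C (ι₁ (y j) - ι₂ (y j) - phiElt x α β ι₁ ι₂ xb xb' j) = 0 := by
  intro j
  have hcl (i : Fin n) : Dd A (x i) = 0 :=
    hpure.1 _ (hx_span ▸ Submodule.subset_span (Set.mem_range_self i))
  have hgr (i : Fin n) : x i ∈ Gr A (e i) := S.V_le _ (hx_mem i)
  have hcomm {f g : A →ₐ[ℚ] C} (hf : IsDGAHom f) (hg : IsDGAHom g) (p q : Fin n) :
      f (x p) * g (x q) = g (x q) * f (x p) :=
    mul_comm_of_mem_Gr_even (he_even p) (hf.2 _ _ (hgr p)) (hg.2 _ _ (hgr q))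
  have hd (p q : Fin n) : Dd C ((ι₁ (x p) - ι₂ (x p)) * (xb q + xb' q)) =
      (ι₁ (x p) - ι₂ (x p)) * (ι₁ (x q) + ι₂ (x q)) := by
    rw [Dd_mul_of_even_cocycle (he_even p)
      (Submodule.sub_mem _ (hι₁.2 _ _ (hgr p)) (hι₂.2 _ _ (hgr p)))
      (by rw [map_sub, ← hι₁.1, ← hι₂.1, hcl, map_zero, map_zero, sub_zero]),
      map_add, hdxb, hdxb']
  have hsq (k : Fin n) : (ι₁ (x k) - ι₂ (x k)) * (ι₁ (x k) + ι₂ (x k)) =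
      ι₁ (x k) ^ 2 - ι₂ (x k) ^ 2 := by
    rw [sq, sq, Commute.mul_self_sub_mul_self_eq' (hcomm hι₁ hι₂ k k)]
  have hcross (p q : Fin n) :
      (1 / 2 : ℚ) • (if p < q then
          β j p q • ((ι₁ (x p) - ι₂ (x p)) * (ι₁ (x q) + ι₂ (x q))) else 0) +
        (1 / 2 : ℚ) • (if p < q then
          β j p q • ((ι₁ (x q) - ι₂ (x q)) * (ι₁ (x p) + ι₂ (x p))) else 0) =
      (if p < q then β j p q • (ι₁ (x p) * ι₁ (x q)) else 0) -
        (if p < q then β j p q • (ι₂ (x p) * ι₂ (x q)) else 0) := by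
    split_ifs
    · rw [← smul_add, ← smul_add, sub_mul_add_add_sub_mul_add (hcomm hι₁ hι₁ p q)
        (hcomm hι₁ hι₂ p q) (hcomm hι₂ hι₁ p q) (hcomm hι₂ hι₂ p q), two_mul]
      module
    · simp
  have hphi : Dd C (phiElt x α β ι₁ ι₂ xb xb' j) = ι₁ (Dd A (y j)) - ι₂ (Dd A (y j)) := by
    simp only [phiElt, hdy, map_add, map_sum, map_smul, apply_ite (Dd C), apply_ite ι₁,
      apply_ite ι₂, map_zero, map_mul, map_pow, hd, hsq]
    rw [add_assoc, add_sub_add_comm]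
    congr 1
    · simp only [smul_sub, Finset.sum_sub_distrib]
    · simp only [Finset.smul_sum, ← Finset.sum_add_distrib, ← Finset.sum_sub_distrib, hcross]
  rw [map_sub, map_sub, hphi, ← hι₁.1, ← hι₂.1, sub_self]

end RHT
end
end
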